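/- arXiv:1612.08637 — 2 statements merged into one kernel-verified Lean document; each statement's English description precedes it below -/
import Mathlib

section
/- lim_{r → ∞} C_1([-1,1],[-r,r]) = 2, where the limit is over real r → ∞. -/
open MeasureTheory Complex Pointwise

noncomputable section

/-- Positive definiteness for complex-valued functions on `ℝ`. -/
def IsPosDefC1 (f : ℝ → ℂ) : Prop :=
  ∀ (X : Finset ℝ) (c : ℝ → ℂ),
    0 ≤ (∑ a ∈ X, ∑ b ∈ X, c a * (starRingEnd ℂ) (c b) * f (a - b)).re ∧
    (∑ a ∈ X, ∑ b ∈ X, c a * (starRingEnd ℂ) (c b) * f (a - b)).im = 0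

/-- Positive definiteness for real-valued functions on `ℝ`. -/
def IsPosDefR1 (f : ℝ → ℝ) : Prop :=
  IsPosDefC1 (fun x => (f x : ℂ))

/-- The set of ratios `(|V|⁻¹ ∫_V f) / (|U|⁻¹ ∫_U f)` over nonzero continuous
non-negative positive definite `f : ℝ → ℝ`. -/
def ratioSet1 (U V : Set ℝ) : Set ℝ :=
  { c | ∃ f : ℝ → ℝ, Continuous f ∧ (∀ x, 0 ≤ f x) ∧ IsPosDefR1 f ∧
      f ≠ 0 ∧ 0 < ∫ x in U, f x ∧
      c = ((volume V).toReal⁻¹ * ∫ x in V, f x) /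
          ((volume U).toReal⁻¹ * ∫ x in U, f x) }

/-- The sharp constant `C_1(U,V)`. -/
def doublingConst1 (U V : Set ℝ) : ℝ := sSup (ratioSet1 U V)

theorem posdef_family {f : ℝ → ℝ} (hf : IsPosDefR1 f) {ι : Type} [Fintype ι]
    (x : ι → ℝ) (d : ι → ℝ) : 0 ≤ ∑ i, ∑ j, d i * d j * f (x i - x j) := by
  classical
  have key : ∀ G : ℝ → ℝ, ∑ a ∈ Finset.univ.image x,
      (∑ i with x i = a, d i) * G a = ∑ i, d i * G (x i) := by
    intro G
    rw [← Finset.sum_fiberwise_of_maps_to (s := Finset.univ) (t := Finset.univ.image x) (g := x)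
      (fun i _ => Finset.mem_image_of_mem x (Finset.mem_univ i))]
    refine Finset.sum_congr rfl fun a _ => ?_
    rw [Finset.sum_mul]
    refine Finset.sum_congr rfl fun i hi => ?_
    rw [(Finset.mem_filter.1 hi).2]
  have h := (hf (Finset.univ.image x) (fun a => ((∑ i with x i = a, d i : ℝ) : ℂ))).1
  have e : (∑ a ∈ Finset.univ.image x, ∑ b ∈ Finset.univ.image x,
      ((∑ i with x i = a, d i : ℝ) : ℂ) * (starRingEnd ℂ) ((∑ i with x i = b, d i : ℝ) : ℂ)
        * ((f (a - b) : ℝ) : ℂ)) =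
      ((∑ i, ∑ j, d i * d j * f (x i - x j) : ℝ) : ℂ) := by
    simp only [Complex.conj_ofReal]
    norm_cast
    have : ∀ a, ∑ b ∈ Finset.univ.image x, (∑ i with x i = a, d i) * (∑ i with x i = b, d i)
        * f (a - b) = (∑ i with x i = a, d i) * ∑ j, d j * f (a - x j) := by
      intro a
      rw [← key (fun b => f (a - b)), Finset.mul_sum]
      exact Finset.sum_congr rfl fun b _ => by ring
    simp only [this]
    rw [key (fun a => ∑ j, d j * f (a - x j))]
    refine Finset.sum_congr rfl fun i _ => ?_
    rw [Finset.mul_sum]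
    exact Finset.sum_congr rfl fun b _ => by ring
  rw [e, Complex.ofReal_re] at h
  exact h

theorem posdef_shift {f : ℝ → ℝ} (hf : IsPosDefR1 f) (N : ℕ) (y : ℕ → ℝ) (t : ℝ) :
    (∑ j ∈ Finset.range N, ∑ i ∈ Finset.range N, f (y i - y j + t)) +
    (∑ j ∈ Finset.range N, ∑ i ∈ Finset.range N, f (y i - y j + -t)) ≤
    2 * ∑ j ∈ Finset.range N, ∑ i ∈ Finset.range N, f (y i - y j + 0) := by
  have h := posdef_family hf (ι := Fin N ⊕ Fin N)
    (Sum.elim (fun i => y i + t) (fun i => y i)) (Sum.elim (fun _ => 1) (fun _ => -1))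
  simp only [Fintype.sum_sum_type, Sum.elim_inl, Sum.elim_inr, Finset.sum_add_distrib] at h
  simp only [Finset.sum_range]
  have e1 : ∀ i j : Fin N, y i + t - (y j + t) = y i - y j + 0 := fun i j => by ring
  have e2 : ∀ i j : Fin N, y i + t - y j = y i - y j + t := fun i j => by ring
  have e3 : ∀ i j : Fin N, y i - (y j + t) = y i - y j + -t := fun i j => by ring
  have e4 : ∀ i j : Fin N, y i - y j = y i - y j + 0 := fun i j => by ring
  simp only [e1, e2, e3] at h
  simp only [one_mul, mul_one, neg_mul, mul_neg, neg_neg, Finset.sum_neg_distrib] at h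
  simp only [add_zero] at h ⊢
  rw [Finset.sum_comm (f := fun j i : Fin N => f (y i - y j + t)),
    Finset.sum_comm (f := fun j i : Fin N => f (y i - y j + -t)),
    Finset.sum_comm (f := fun j i : Fin N => f (y i - y j))]
  linarith

theorem riemann_bound {g : ℝ → ℝ} (hg : Continuous g) (N : ℕ) (hN : 0 < N) (ε : ℝ)
    (h : ∀ x ∈ Set.Icc (0:ℝ) 1, ∀ y ∈ Set.Icc (0:ℝ) 1, |x - y| ≤ 1 / N → |g x - g y| ≤ ε) :
    |(1 / N : ℝ) * ∑ i ∈ Finset.range N, g (i / N) - ∫ x in (0:ℝ)..1, g x| ≤ ε := by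
  have hN' : (0:ℝ) < N := by exact_mod_cast hN
  have e : ∫ x in (0:ℝ)..1, g x =
      ∑ i ∈ Finset.range N, ∫ x in ((i:ℕ) / N : ℝ)..((i+1:ℕ) / N : ℝ), g x := by
    rw [intervalIntegral.sum_integral_adjacent_intervals (a := fun i : ℕ => (i / N : ℝ))
      (fun k _ => hg.intervalIntegrable _ _)]
    simp [hN'.ne']
  rw [e, Finset.mul_sum, ← Finset.sum_sub_distrib]
  refine (Finset.abs_sum_le_sum_abs _ _).trans ?_
  have : ∀ i ∈ Finset.range N, |(1 / N : ℝ) * g (i / N) -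
      ∫ x in ((i:ℕ) / N : ℝ)..((i+1:ℕ) / N : ℝ), g x| ≤ ε * (1 / N) := by
    intro i hi
    have hi' : ((i:ℝ) + 1) ≤ N := by exact_mod_cast Finset.mem_range.1 hi
    have hlen : ((i+1:ℕ) / N : ℝ) - (i:ℕ) / N = 1 / N := by push_cast; ring
    have e2 : (1 / N : ℝ) * g (i / N) - ∫ x in ((i:ℕ) / N : ℝ)..((i+1:ℕ) / N : ℝ), g x =
        ∫ x in ((i:ℕ) / N : ℝ)..((i+1:ℕ) / N : ℝ), (g (i / N) - g x) := by
      rw [intervalIntegral.integral_sub (by simp) (hg.intervalIntegrable _ _),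
        intervalIntegral.integral_const, hlen, smul_eq_mul]
    rw [e2, ← Real.norm_eq_abs]
    have hle : ((i:ℕ) / N : ℝ) ≤ ((i+1:ℕ) / N : ℝ) := by
      have : (0:ℝ) < 1 / N := by positivity
      linarith
    refine (intervalIntegral.norm_integral_le_of_norm_le_const (C := ε) ?_).trans ?_
    · intro x hx
      rw [Set.uIoc_of_le hle] at hx
      have h0 : (0:ℝ) ≤ (i:ℕ) / N := by positivity
      have h1 : ((i+1:ℕ) / N : ℝ) ≤ 1 := by
        rw [div_le_one hN']; push_cast; exact hi'
      refine h _ ⟨h0, by linarith⟩ _ ⟨by linarith [hx.1], by linarith [hx.2]⟩ ?_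
      rw [abs_le]
      constructor <;> linarith [hx.1, hx.2]
    · rw [hlen, abs_of_pos (by positivity)]
  refine (Finset.sum_le_sum this).trans ?_
  simp only [Finset.sum_const, Finset.card_range, nsmul_eq_mul]
  apply le_of_eq; field_simp

theorem upper_int {f : ℝ → ℝ} (hc : Continuous f) (h0 : ∀ x, 0 ≤ f x) (hf : IsPosDefR1 f)
    (R : ℕ) : ∫ x in (-R:ℝ)..R, f x ≤ (2 * R + 1) * ∫ x in (-1:ℝ)..1, f x := by
  have hR : (0:ℝ) ≤ R := Nat.cast_nonneg R
  suffices H : ∀ ε > 0, ∫ x in (-R:ℝ)..R, f x ≤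
      (2 * R + 1) * (∫ x in (-1:ℝ)..1, f x) + (2 * (2 * R + 1)) * ε by
    refine le_of_forall_pos_le_add fun ε hε => ?_
    have := H (ε / (2 * (2 * R + 1))) (by positivity)
    rwa [mul_div_cancel₀ _ (by positivity)] at this
  intro ε hε
  -- uniform continuity
  have huc := (isCompact_Icc (a := (-R - 2 : ℝ)) (b := R + 2)).uniformContinuousOn_of_continuous
    hc.continuousOn
  rw [Metric.uniformContinuousOn_iff] at huc
  obtain ⟨δ, hδ, huc⟩ := huc ε hε
  obtain ⟨n, hn⟩ := exists_nat_one_div_lt hδ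
  set N : ℕ := n + 1 with hNdef
  have hN : 0 < N := Nat.succ_pos n
  have hN' : (0:ℝ) < N := by exact_mod_cast hN
  have hnδ : (1:ℝ) / N < δ := by rw [hNdef]; push_cast; exact hn
  have rie : ∀ v ∈ Set.Icc (0:ℝ) 1, ∀ t : ℝ, |t| ≤ R →
      |(1 / N : ℝ) * ∑ i ∈ Finset.range N, f (i / N - v + t) -
        ∫ x in (t - v)..(t - v + 1), f x| ≤ ε := by
    intro v hv t ht
    have ht' := abs_le.1 ht
    have := riemann_bound (g := fun x => f (x - v + t)) (by fun_prop) N hN ε (by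
      intro x hx y hy hxy
      have := huc (x - v + t) ⟨by linarith [hx.1, hv.2], by linarith [hx.2, hv.1]⟩
        (y - v + t) ⟨by linarith [hy.1, hv.2], by linarith [hy.2, hv.1]⟩ (by
          rw [Real.dist_eq]
          have : x - v + t - (y - v + t) = x - y := by ring
          rw [this]; linarith)
      rw [Real.dist_eq] at this
      exact this.le)
    have e : ∫ x in (0:ℝ)..1, f (x - v + t) = ∫ x in (t - v)..(t - v + 1), f x := by
      have := intervalIntegral.integral_comp_add_right (a := 0) (b := 1) f (t - v)
      rw [zero_add, add_comm 1] at this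
      rw [← this]
      congr 1; ext x; congr 1; ring
    rwa [e] at this
  set Q : ℝ → ℝ := fun t => ∑ j ∈ Finset.range N, ((1 / N : ℝ) * ∑ i ∈ Finset.range N,
    f ((i:ℝ) / N - (j:ℝ) / N + t)) with hQ
  have hjv : ∀ j ∈ Finset.range N, ((j:ℝ) / N) ∈ Set.Icc (0:ℝ) 1 := by
    intro j hj
    have : (j:ℝ) ≤ N := by exact_mod_cast (Finset.mem_range.1 hj).le
    exact ⟨by positivity, by rwa [div_le_one hN']⟩
  have hQs : ∀ t, Q t + Q (-t) ≤ 2 * Q 0 := by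
    intro t
    have := posdef_shift hf N (fun i => (i:ℝ) / N) t
    simp only [hQ, ← Finset.mul_sum]
    have h1 : (0:ℝ) < 1 / N := by positivity
    nlinarith
  have hint : ∀ a b : ℝ, IntervalIntegrable f volume a b := fun a b => hc.intervalIntegrable a b
  have hmono : ∀ a b c d : ℝ, c ≤ a → a ≤ b → b ≤ d →
      ∫ x in a..b, f x ≤ ∫ x in c..d, f x := by
    intro a b c d h1 h2 h3
    exact intervalIntegral.integral_mono_interval h1 h2 h3 (Filter.Eventually.of_forall h0)
      (hint _ _)
  -- upper bound of Q 0
  have hQ0 : Q 0 ≤ N * ((∫ x in (-1:ℝ)..1, f x) + ε) := by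
    have : ∀ j ∈ Finset.range N, ((1 / N : ℝ) * ∑ i ∈ Finset.range N,
        f ((i:ℝ) / N - (j:ℝ) / N + 0)) ≤ (∫ x in (-1:ℝ)..1, f x) + ε := by
      intro j hj
      have hv := hjv j hj
      have h1 := (abs_le.1 (rie _ hv 0 (by simp))).2
      have h2 := hmono (0 - (j:ℝ) / N) (0 - (j:ℝ) / N + 1) (-1) 1 (by linarith [hv.2])
        (by linarith) (by linarith [hv.1])
      linarith
    have := Finset.sum_le_card_nsmul _ _ _ this
    rwa [Finset.card_range, nsmul_eq_mul] at this
  have hQsum : N * ((∫ x in (-R:ℝ)..R, f x) - (2 * R + 1) * ε) ≤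
      ∑ k ∈ Finset.range (2 * R + 1), Q ((k:ℝ) - R) := by
    rw [hQ, Finset.sum_comm]
    have : ∀ j ∈ Finset.range N, (∫ x in (-R:ℝ)..R, f x) - (2 * R + 1) * ε ≤
        ∑ k ∈ Finset.range (2 * R + 1), ((1 / N : ℝ) * ∑ i ∈ Finset.range N,
        f ((i:ℝ) / N - (j:ℝ) / N + ((k:ℝ) - R))) := by
      intro j hj
      have hv := hjv j hj
      have hk : ∀ k ∈ Finset.range (2 * R + 1),
          (∫ x in ((k:ℕ) - R - (j:ℝ) / N : ℝ)..((k+1:ℕ) - R - (j:ℝ) / N : ℝ), f x) - ε ≤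
          ((1 / N : ℝ) * ∑ i ∈ Finset.range N, f ((i:ℝ) / N - (j:ℝ) / N + ((k:ℝ) - R))) := by
        intro k hk
        have hk' : (k:ℝ) ≤ 2 * R := by
          exact_mod_cast Nat.lt_succ_iff.1 (Finset.mem_range.1 hk)
        have hk0 : (0:ℝ) ≤ k := Nat.cast_nonneg k
        have h1 := (abs_le.1 (rie _ hv ((k:ℝ) - R) (abs_le.2 ⟨by linarith, by linarith⟩))).1
        have e : ((k+1:ℕ) - R - (j:ℝ) / N : ℝ) = (k:ℝ) - R - (j:ℝ) / N + 1 := by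
          push_cast; ring
        rw [e]
        linarith
      have h2 := Finset.sum_le_sum hk
      rw [Finset.sum_sub_distrib, intervalIntegral.sum_integral_adjacent_intervals
        (a := fun k : ℕ => (k - R - (j:ℝ) / N : ℝ)) (fun k _ => hint _ _)] at h2
      have h3 := hmono (-R) R (((0:ℕ):ℝ) - R - (j:ℝ) / N) (((2 * R + 1 : ℕ):ℝ) - R - (j:ℝ) / N)
        (by push_cast; linarith [hv.1]) (by linarith) (by push_cast; linarith [hv.2])
      simp only [Finset.sum_const, Finset.card_range, nsmul_eq_mul] at h2
      push_cast at h2 h3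
      linarith
    have := Finset.card_nsmul_le_sum _ _ _ this
    rwa [Finset.card_range, nsmul_eq_mul] at this
  have hrefl : ∑ k ∈ Finset.range (2 * R + 1), Q (-((k:ℝ) - R)) =
      ∑ k ∈ Finset.range (2 * R + 1), Q ((k:ℝ) - R) := by
    rw [← Finset.sum_range_reflect]
    refine Finset.sum_congr rfl fun k hk => ?_
    have hk' : k ≤ 2 * R := Nat.lt_succ_iff.1 (Finset.mem_range.1 hk)
    congr 1
    have : 2 * R + 1 - 1 - k = 2 * R - k := by omega
    rw [this, Nat.cast_sub hk']
    push_cast; ring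
  have hfin := Finset.sum_le_sum (s := Finset.range (2 * R + 1))
    (fun k _ => hQs ((k:ℝ) - R))
  rw [Finset.sum_add_distrib, hrefl] at hfin
  simp only [Finset.sum_const, Finset.card_range, nsmul_eq_mul] at hfin
  push_cast at hfin
  have h1 : N * ((∫ x in (-R:ℝ)..R, f x) - (2 * R + 1) * ε) ≤
      N * ((2 * R + 1) * ((∫ x in (-1:ℝ)..1, f x) + ε)) := by
    have : (2 * (R:ℝ) + 1) * Q 0 ≤ (2 * R + 1) * (N * ((∫ x in (-1:ℝ)..1, f x) + ε)) :=
      mul_le_mul_of_nonneg_left hQ0 (by positivity)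
    linarith
  have h2 := le_of_mul_le_mul_left h1 hN'
  linarith

theorem ratio_eq {f : ℝ → ℝ} {r : ℝ} (hr : 0 < r) :
    ((volume (Set.Icc (-r) r)).toReal⁻¹ * ∫ x in Set.Icc (-r) r, f x) /
      ((volume (Set.Icc (-1:ℝ) 1)).toReal⁻¹ * ∫ x in Set.Icc (-1:ℝ) 1, f x) =
    (∫ x in (-r)..r, f x) / (r * ∫ x in (-1:ℝ)..1, f x) := by
  rw [integral_Icc_eq_integral_Ioc, integral_Icc_eq_integral_Ioc,
    ← intervalIntegral.integral_of_le (by linarith), ← intervalIntegral.integral_of_le (by norm_num),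
    Real.volume_Icc, Real.volume_Icc, ENNReal.toReal_ofReal (by linarith),
    ENNReal.toReal_ofReal (by norm_num)]
  have : r - -r = 2 * r := by ring
  rw [this]
  by_cases h : ∫ x in (-1:ℝ)..1, f x = 0
  · simp [h]
  · field_simp
    ring

theorem upper_ratio {r : ℝ} (hr : 0 < r) {c : ℝ}
    (hc : c ∈ ratioSet1 (Set.Icc (-1:ℝ) 1) (Set.Icc (-r) r)) : c ≤ 2 + 3 / r := by
  obtain ⟨f, hcont, h0, hpd, -, hpos, rfl⟩ := hc
  rw [ratio_eq hr]
  rw [integral_Icc_eq_integral_Ioc, ← intervalIntegral.integral_of_le (by norm_num)] at hpos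
  have h1 := upper_int hcont h0 hpd ⌈r⌉₊
  have h2 : r ≤ (⌈r⌉₊:ℝ) := Nat.le_ceil r
  have h3 : (⌈r⌉₊:ℝ) < r + 1 := Nat.ceil_lt_add_one hr.le
  have h4 : ∫ x in (-r)..r, f x ≤ ∫ x in (-(⌈r⌉₊:ℝ))..⌈r⌉₊, f x :=
    intervalIntegral.integral_mono_interval (by linarith) (by linarith) h2
      (Filter.Eventually.of_forall h0) (hcont.intervalIntegrable _ _)
  rw [div_le_iff₀ (by positivity)]
  have e : (2 + 3 / r) * (r * ∫ x in (-1:ℝ)..1, f x) = (2 * r + 3) * ∫ x in (-1:ℝ)..1, f x := by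
    field_simp
  rw [e]
  nlinarith

theorem posdef_mul_cos {f : ℝ → ℝ} (hf : IsPosDefR1 f) (w : ℝ) :
    IsPosDefR1 (fun x => f x * ((1 + Real.cos (w * x)) / 2)) := by
  intro X c
  have h1 := hf X c
  have h2 := hf X (fun a => c a * Complex.exp ((w * a : ℝ) * I))
  have h3 := hf X (fun a => c a * Complex.exp (-((w * a : ℝ) * I)))
  have e : (∑ a ∈ X, ∑ b ∈ X, c a * (starRingEnd ℂ) (c b) *
      ((f (a - b) * ((1 + Real.cos (w * (a - b))) / 2) : ℝ) : ℂ)) =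
      ((1 / 2 : ℝ) : ℂ) * (∑ a ∈ X, ∑ b ∈ X, c a * (starRingEnd ℂ) (c b) * (f (a - b) : ℂ)) +
      ((1 / 4 : ℝ) : ℂ) * (∑ a ∈ X, ∑ b ∈ X, (c a * Complex.exp ((w * a : ℝ) * I)) *
        (starRingEnd ℂ) (c b * Complex.exp ((w * b : ℝ) * I)) * (f (a - b) : ℂ)) +
      ((1 / 4 : ℝ) : ℂ) * (∑ a ∈ X, ∑ b ∈ X, (c a * Complex.exp (-((w * a : ℝ) * I))) *
        (starRingEnd ℂ) (c b * Complex.exp (-((w * b : ℝ) * I))) * (f (a - b) : ℂ)) := by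
    simp only [Finset.mul_sum, ← Finset.sum_add_distrib]
    refine Finset.sum_congr rfl fun a _ => Finset.sum_congr rfl fun b _ => ?_
    rw [map_mul, map_mul, ← Complex.exp_conj, ← Complex.exp_conj]
    simp only [map_neg, map_mul, Complex.conj_ofReal, Complex.conj_I]
    have ec : ((Real.cos (w * (a - b)) : ℝ) : ℂ) =
        (Complex.exp ((w * a : ℝ) * I) * Complex.exp ((w * b : ℝ) * -I) +
         Complex.exp (-((w * a : ℝ) * I)) * Complex.exp (-((w * b : ℝ) * -I))) / 2 := by
      rw [Complex.ofReal_cos, Complex.cos, ← Complex.exp_add, ← Complex.exp_add]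
      congr 3 <;> (push_cast; ring)
    push_cast at ec ⊢
    rw [ec]
    ring
  dsimp only at h1 h2 h3 ⊢
  rw [e]
  simp only [Complex.add_re, Complex.add_im, Complex.re_ofReal_mul, Complex.im_ofReal_mul]
  rw [h1.2, h2.2, h3.2]
  exact ⟨by linarith [h1.1, h2.1, h3.1], by ring⟩

theorem posdef_one : IsPosDefR1 (fun _ => 1) := by
  intro X c
  have e : (∑ a ∈ X, ∑ b ∈ X, c a * (starRingEnd ℂ) (c b) * ((1:ℝ) : ℂ)) =
      ((Complex.normSq (∑ a ∈ X, c a) : ℝ) : ℂ) := by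
    rw [Complex.normSq_eq_conj_mul_self, map_sum, mul_comm, Finset.sum_mul_sum]
    simp
  dsimp only
  rw [e]
  exact ⟨by rw [Complex.ofReal_re]; exact Complex.normSq_nonneg _, Complex.ofReal_im _⟩

/-- The test functions. -/
def tst (w : ℝ) (n : ℕ) (x : ℝ) : ℝ := ((1 + Real.cos (w * x)) / 2) ^ n

theorem tst_posdef (w : ℝ) (n : ℕ) : IsPosDefR1 (tst w n) := by
  induction n with
  | zero =>
    have : tst w 0 = fun _ => 1 := by ext x; simp [tst]
    rw [this]; exact posdef_one
  | succ n ih =>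
    have : tst w (n+1) = fun x => tst w n x * ((1 + Real.cos (w * x)) / 2) := by
      ext x; simp [tst, pow_succ]
    rw [this]; exact posdef_mul_cos ih w

theorem tst_cont (w : ℝ) (n : ℕ) : Continuous (tst w n) := by
  unfold tst; fun_prop

theorem base_nonneg (y : ℝ) : 0 ≤ (1 + Real.cos y) / 2 := by
  linarith [Real.neg_one_le_cos y]

theorem tst_nonneg (w : ℝ) (n : ℕ) (x : ℝ) : 0 ≤ tst w n x := pow_nonneg (base_nonneg _) n

theorem tst_periodic {p : ℝ} (hp : 0 < p) (n : ℕ) :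
    Function.Periodic (tst (2 * Real.pi / p) n) p := by
  intro x
  have : 2 * Real.pi / p * (x + p) = 2 * Real.pi / p * x + 2 * Real.pi := by field_simp
  simp only [tst, this, Real.cos_add_two_pi]

theorem tst_conc {p : ℝ} (hp : 1 < p) (hp2 : p < 2) : ∃ n : ℕ,
    0 < (∫ x in (0:ℝ)..p, tst (2 * Real.pi / p) n x) ∧
    (∫ x in (-1:ℝ)..1, tst (2 * Real.pi / p) n x) ≤
      p * ∫ x in (0:ℝ)..p, tst (2 * Real.pi / p) n x := by
  set w := 2 * Real.pi / p with hw
  have hpi := Real.pi_pos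
  have hw0 : 0 < w := by positivity
  have hwp : w * p = 2 * Real.pi := by rw [hw]; field_simp
  set η := (p - 1) / 2 with hη
  have hη0 : 0 < η := by rw [hη]; linarith
  set q := (1 + Real.cos (w * (p - 1))) / 2 with hq
  set q' := (1 + Real.cos (w * η)) / 2 with hq'
  have hwpi : w * (p - 1) ≤ Real.pi := by nlinarith
  have hqq : q < q' := by
    have : Real.cos (w * (p - 1)) < Real.cos (w * η) := by
      apply Real.cos_lt_cos_of_nonneg_of_le_pi (by positivity) hwpi
      apply mul_lt_mul_of_pos_left _ hw0
      rw [hη]; linarith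
    rw [hq, hq']; linarith
  have hq0 : 0 ≤ q := base_nonneg _
  have hq'0 : 0 < q' := hq0.trans_lt hqq
  obtain ⟨n, hn⟩ := exists_pow_lt_of_lt_one (show 0 < (p - 1) * η by nlinarith)
    ((div_lt_one hq'0).2 hqq)
  rw [div_pow, div_lt_iff₀ (by positivity)] at hn
  refine ⟨n, ?_⟩
  have hint : ∀ a b : ℝ, IntervalIntegrable (tst w n) volume a b :=
    fun a b => (tst_cont w n).intervalIntegrable a b
  have hlow : η * q' ^ n ≤ ∫ x in (0:ℝ)..p, tst w n x := by
    have h1 : ∫ x in (0:ℝ)..η, (fun _ => q' ^ n) x ≤ ∫ x in (0:ℝ)..η, tst w n x := by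
      apply intervalIntegral.integral_mono_on hη0.le (by simp) (hint _ _)
      intro x hx
      apply pow_le_pow_left₀ hq'0.le
      have : Real.cos (w * η) ≤ Real.cos (w * x) := by
        apply Real.cos_le_cos_of_nonneg_of_le_pi (mul_nonneg hw0.le hx.1)
        · nlinarith
        · exact mul_le_mul_of_nonneg_left hx.2 hw0.le
      rw [hq']; linarith
    have h2 : ∫ x in (0:ℝ)..η, tst w n x ≤ ∫ x in (0:ℝ)..p, tst w n x :=
      intervalIntegral.integral_mono_interval le_rfl hη0.le (by rw [hη]; linarith)
        (Filter.Eventually.of_forall (tst_nonneg w n)) (hint _ _)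
    simp at h1
    linarith
  have hup : ∫ x in (p-1)..1, tst w n x ≤ q ^ n := by
    have h1 : ∫ x in (p-1)..1, tst w n x ≤ ∫ x in (p-1)..1, (fun _ => q ^ n) x := by
      apply intervalIntegral.integral_mono_on (by linarith) (hint _ _) (by simp)
      intro x hx
      apply pow_le_pow_left₀ (base_nonneg _)
      have : Real.cos (w * x) ≤ Real.cos (w * (p - 1)) := by
        by_cases hx2 : w * x ≤ Real.pi
        · exact Real.cos_le_cos_of_nonneg_of_le_pi (by nlinarith) hx2
            (mul_le_mul_of_nonneg_left hx.1 hw0.le)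
        · have e : Real.cos (w * x) = Real.cos (w * (p - x)) := by
            rw [mul_sub, hwp, Real.cos_two_pi_sub]
          rw [e]
          exact Real.cos_le_cos_of_nonneg_of_le_pi (by nlinarith) (by nlinarith)
            (mul_le_mul_of_nonneg_left (by linarith [hx.2]) hw0.le)
      rw [hq]; linarith
    simp only [intervalIntegral.integral_const, smul_eq_mul] at h1
    have : 0 ≤ q ^ n := by positivity
    nlinarith
  have hper : ∫ x in (-1:ℝ)..(p-1), tst w n x = ∫ x in (0:ℝ)..p, tst w n x := by
    have := (tst_periodic (by linarith : 0 < p) n).intervalIntegral_add_eq (-1) 0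
    rw [zero_add, neg_add_eq_sub] at this
    exact this
  have hsplit := intervalIntegral.integral_add_adjacent_intervals (hint (-1) (p-1)) (hint (p-1) 1)
  have hpos : 0 < η * q' ^ n := by positivity
  refine ⟨by linarith, ?_⟩
  nlinarith

theorem lower_ratio {p r : ℝ} (hp : 1 < p) (hp2 : p < 2) (hr : 0 < r) :
    ∃ c ∈ ratioSet1 (Set.Icc (-1:ℝ) 1) (Set.Icc (-r) r), (2 / p - 1 / r) / p ≤ c := by
  obtain ⟨n, hm, hle⟩ := tst_conc hp hp2
  have hp0 : 0 < p := by linarith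
  set f := tst (2 * Real.pi / p) n with hf
  have hint : ∀ a b : ℝ, IntervalIntegrable f volume a b :=
    fun a b => (tst_cont _ n).intervalIntegrable a b
  have hper : Function.Periodic f p := tst_periodic hp0 n
  have hbig : (2 * r / p - 1) * (∫ x in (0:ℝ)..p, f x) ≤ ∫ x in (-r)..r, f x := by
    have h1 := hper.intervalIntegral_add_zsmul_eq ⌊2 * r / p⌋ (-r)
      (fun _ _ => hint _ _)
    have h2 : ∫ x in (-r)..(-r + ⌊2 * r / p⌋ • p), f x ≤ ∫ x in (-r)..r, f x := by
      apply intervalIntegral.integral_mono_interval le_rfl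
      · have : (0:ℝ) ≤ ⌊2 * r / p⌋ := by
          exact_mod_cast Int.floor_nonneg.2 (by positivity)
        rw [zsmul_eq_mul]; nlinarith
      · have := Int.floor_le (2 * r / p)
        rw [le_div_iff₀ hp0] at this
        rw [zsmul_eq_mul]; linarith
      · exact Filter.Eventually.of_forall (tst_nonneg _ n)
      · exact hint _ _
    have h3 := hper.intervalIntegral_add_eq (-r) 0
    rw [zero_add] at h3
    rw [h1, h3, zsmul_eq_mul] at h2
    have h4 := Int.sub_one_lt_floor (2 * r / p)
    nlinarith
  have hsmall : 0 < ∫ x in (-1:ℝ)..1, f x := by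
    have h3 := hper.intervalIntegral_add_eq (-1) 0
    rw [zero_add, neg_add_eq_sub] at h3
    have : ∫ x in (-1:ℝ)..(p-1), f x ≤ ∫ x in (-1:ℝ)..1, f x :=
      intervalIntegral.integral_mono_interval le_rfl (by linarith) (by linarith)
        (Filter.Eventually.of_forall (tst_nonneg _ n)) (hint _ _)
    linarith
  refine ⟨_, ⟨f, tst_cont _ n, tst_nonneg _ n, tst_posdef _ n, ?_, ?_, rfl⟩, ?_⟩
  · intro h
    rw [h] at hsmall
    simp at hsmall
  · rw [integral_Icc_eq_integral_Ioc, ← intervalIntegral.integral_of_le (by norm_num)]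
    exact hsmall
  · rw [ratio_eq hr, le_div_iff₀ (by positivity)]
    by_cases hs : 0 ≤ 2 / p - 1 / r
    · have e : (2 / p - 1 / r) / p * (r * ∫ x in (-1:ℝ)..1, f x) ≤
          (2 / p - 1 / r) / p * (r * (p * ∫ x in (0:ℝ)..p, f x)) := by gcongr
      refine e.trans (le_trans (le_of_eq ?_) hbig)
      field_simp
    · have h1 : (2 / p - 1 / r) / p ≤ 0 := div_nonpos_of_nonpos_of_nonneg (by linarith) hp0.le
      have h2 : 0 ≤ r * ∫ x in (-1:ℝ)..1, f x := by positivity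
      have h3 : 0 ≤ ∫ x in (-r)..r, f x :=
        intervalIntegral.integral_nonneg (by linarith) (fun x _ => tst_nonneg _ n x)
      nlinarith

/-- `C_1([-1,1],[-r,r]) → 2` as `r → ∞` over the reals. -/
theorem one_dim_sharp_constant_limit :
    Filter.Tendsto
      (fun r : ℝ => doublingConst1 (Set.Icc (-1 : ℝ) 1) (Set.Icc (-r) r))
      Filter.atTop (nhds 2) := by
  rw [tendsto_order]
  have hbdd : ∀ r : ℝ, 0 < r → BddAbove (ratioSet1 (Set.Icc (-1:ℝ) 1) (Set.Icc (-r) r)) :=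
    fun r hr => ⟨2 + 3 / r, fun c hc => upper_ratio hr hc⟩
  have hinv : ∀ k : ℝ, Filter.Tendsto (fun r : ℝ => k / r) Filter.atTop (nhds 0) :=
    fun k => Filter.Tendsto.const_div_atTop Filter.tendsto_id k
  constructor
  · intro a ha
    obtain ⟨p, hp, hp2, hpa⟩ : ∃ p : ℝ, 1 < p ∧ p < 2 ∧ a < 2 / p / p := by
      have hc : ContinuousAt (fun p : ℝ => 2 / p / p) 1 := by
        fun_prop (disch := norm_num)
      have h1 : ∀ᶠ p in nhdsWithin (1:ℝ) (Set.Ioi 1), a < 2 / p / p :=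
        (hc.eventually (lt_mem_nhds (by norm_num; exact ha))).filter_mono nhdsWithin_le_nhds
      have h2 : ∀ᶠ p in nhdsWithin (1:ℝ) (Set.Ioi 1), p ∈ Set.Ioo (1:ℝ) 2 :=
        Ioo_mem_nhdsGT (by norm_num)
      obtain ⟨p, h, h'⟩ := (h1.and h2).exists
      exact ⟨p, h'.1, h'.2, h⟩
    have ht : Filter.Tendsto (fun r : ℝ => (2 / p - 1 / r) / p) Filter.atTop
        (nhds ((2 / p - 0) / p)) := ((hinv 1).const_sub _).div_const _
    rw [sub_zero] at ht
    filter_upwards [ht.eventually (lt_mem_nhds hpa), Filter.eventually_gt_atTop 0] with r h1 hr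
    obtain ⟨c, hc, hle⟩ := lower_ratio hp hp2 hr
    exact h1.trans_le (hle.trans (le_csSup (hbdd r hr) hc))
  · intro a ha
    have ht : Filter.Tendsto (fun r : ℝ => 2 + 3 / r) Filter.atTop (nhds (2 + 0)) :=
      (hinv 3).const_add _
    rw [add_zero] at ht
    filter_upwards [ht.eventually (gt_mem_nhds ha), Filter.eventually_gt_atTop 0] with r h1 hr
    obtain ⟨c, hc, -⟩ := lower_ratio (p := 3 / 2) (by norm_num) (by norm_num) hr
    exact (csSup_le ⟨c, hc⟩ (fun c hc => upper_ratio hr hc)).trans_lt h1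
end
end

section
/- Let Λ ⊂ ℝⁿ be a lattice of rank n such that a - b ∉ int(U) for all distinct a, b ∈ Λ (i.e., (1/2)U + Λ is a lattice packing). Then for any 0-symmetric convex body V, C_n(U, V) ≥ |Λ ∩ int(V)| · |U| / |V|. -/
open MeasureTheory Complex Pointwise

noncomputable section

/-- A continuous-type positive definiteness condition for complex-valued
functions on `ℝⁿ`: all finite quadratic forms are real and nonnegative. -/
def IsPosDefC {n : ℕ} (f : (Fin n → ℝ) → ℂ) : Prop :=
  ∀ (X : Finset (Fin n → ℝ)) (c : (Fin n → ℝ) → ℂ),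
    0 ≤ (∑ a ∈ X, ∑ b ∈ X, c a * (starRingEnd ℂ) (c b) * f (a - b)).re ∧
    (∑ a ∈ X, ∑ b ∈ X, c a * (starRingEnd ℂ) (c b) * f (a - b)).im = 0

/-- Positive definiteness for real-valued functions on `ℝⁿ`. -/
def IsPosDefR {n : ℕ} (f : (Fin n → ℝ) → ℝ) : Prop :=
  IsPosDefC (fun x => (f x : ℂ))

/-- The set of ratios `(|V|⁻¹ ∫_V f) / (|U|⁻¹ ∫_U f)` over nonzero continuous
non-negative positive definite `f`. -/
def ratioSet (n : ℕ) (U V : Set (Fin n → ℝ)) : Set ℝ :=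
  { c | ∃ f : (Fin n → ℝ) → ℝ, Continuous f ∧ (∀ x, 0 ≤ f x) ∧ IsPosDefR f ∧
      f ≠ 0 ∧ 0 < ∫ x in U, f x ∧
      c = ((volume V).toReal⁻¹ * ∫ x in V, f x) /
          ((volume U).toReal⁻¹ * ∫ x in U, f x) }

/-- The sharp constant `C_n(U,V)` in the doubling-type condition at the origin. -/
def doublingConst (n : ℕ) (U V : Set (Fin n → ℝ)) : ℝ := sSup (ratioSet n U V)

/-- A `0`-symmetric convex body in `ℝⁿ`. -/
def IsSymConvexBody {n : ℕ} (U : Set (Fin n → ℝ)) : Prop :=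
  Convex ℝ U ∧ IsCompact U ∧ (interior U).Nonempty ∧ U = -U

theorem posdef_multi {n : ℕ} {f : (Fin n → ℝ) → ℝ} (hf : IsPosDefR f) {ι : Type*} (s : Finset ι)
    (p : ι → (Fin n → ℝ)) (c : ι → ℝ) :
    0 ≤ ∑ i ∈ s, ∑ j ∈ s, c i * c j * f (p i - p j) := by
  classical
  have h := (hf (s.image p) (fun z => ((∑ i ∈ s with p i = z, c i : ℝ) : ℂ))).1
  have e : (∑ a ∈ s.image p, ∑ b ∈ s.image p, ((∑ i ∈ s with p i = a, c i : ℝ) : ℂ) *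
      (starRingEnd ℂ) ((∑ i ∈ s with p i = b, c i : ℝ) : ℂ) * (f (a - b) : ℂ))
      = ((∑ i ∈ s, ∑ j ∈ s, c i * c j * f (p i - p j) : ℝ) : ℂ) := by
    simp only [Complex.conj_ofReal]
    norm_cast
    rw [← Finset.sum_fiberwise_of_maps_to (s := s) (t := s.image p) (g := p)
      (fun i hi => Finset.mem_image_of_mem p hi)]
    refine Finset.sum_congr rfl fun a _ => ?_
    have : ∀ i ∈ s.filter (fun i => p i = a), ∑ j ∈ s, c i * c j * f (p i - p j) =
        ∑ b ∈ s.image p, ∑ j ∈ s with p j = b, c i * c j * f (a - b) := by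
      intro i hi
      rw [← Finset.sum_fiberwise_of_maps_to (s := s) (t := s.image p) (g := p)
        (fun i hi => Finset.mem_image_of_mem p hi)]
      refine Finset.sum_congr rfl fun b _ => Finset.sum_congr rfl fun j hj => ?_
      rw [(Finset.mem_filter.1 hi).2, (Finset.mem_filter.1 hj).2]
    rw [Finset.sum_congr rfl this, Finset.sum_comm]
    refine Finset.sum_congr rfl fun b _ => ?_
    rw [Finset.sum_mul_sum, Finset.sum_mul]
    refine Finset.sum_congr rfl fun i _ => ?_
    rw [Finset.sum_mul]
  simp only at h
  rw [e] at h
  simpa using h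

theorem simple_integral {E : Type*} [MeasurableSpace E] (μ : Measure E) [IsFiniteMeasure μ]
    (s : SimpleFunc E E) (g : E → ℝ) :
    ∫ x, g (s x) ∂μ = ∑ b ∈ s.range, μ.real (s ⁻¹' {b}) * g b := by
  classical
  have : ∀ x, g (s x) = ∑ b ∈ s.range, (s ⁻¹' {b}).indicator (fun _ => g b) x := by
    intro x
    rw [Finset.sum_eq_single (s x)]
    · simp
    · intro b _ hb
      simp [hb.symm]
    · intro h
      exact absurd (s.mem_range_self x) h
  simp_rw [this]
  rw [integral_finsetSum]
  · refine Finset.sum_congr rfl fun b _ => ?_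
    rw [integral_indicator (s.measurableSet_fiber b), integral_const]
    simp [Measure.real]
  · intro b _
    exact (integrable_const _).indicator (s.measurableSet_fiber b)

theorem kernel_nonneg {n : ℕ} (K : (Fin n → ℝ) → (Fin n → ℝ) → ℝ)
    (hK : Continuous fun z : (Fin n → ℝ) × (Fin n → ℝ) => K z.1 z.2)
    (hpos : ∀ (X : Finset (Fin n → ℝ)) (w : (Fin n → ℝ) → ℝ),
      0 ≤ ∑ a ∈ X, ∑ b ∈ X, w a * w b * K a b) (W : Set (Fin n → ℝ)) (hW : IsCompact W)
    (h0 : 0 ∈ W) :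
    0 ≤ ∫ x in W, ∫ y in W, K x y := by
  set μ := (volume : Measure (Fin n → ℝ)).restrict W with hμ
  have : IsFiniteMeasure μ := ⟨by rw [hμ, Measure.restrict_apply_univ]; exact hW.measure_lt_top⟩
  let φ : ℕ → SimpleFunc (Fin n → ℝ) (Fin n → ℝ) := fun k =>
    SimpleFunc.approxOn id measurable_id W 0 h0 k
  have hφ : ∀ k x, φ k x ∈ W := fun k x => SimpleFunc.approxOn_mem _ h0 k x
  obtain ⟨C, hC⟩ := (hW.prod hW).exists_bound_of_continuousOn hK.continuousOn
  have hWm : MeasurableSet W := hW.measurableSet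
  have hmem : ∀ᵐ x ∂μ, x ∈ W := ae_restrict_mem hWm
  have hmeas : ∀ k, AEStronglyMeasurable
      (fun z : (Fin n → ℝ) × (Fin n → ℝ) => K (φ k z.1) (φ k z.2)) (μ.prod μ) := by
    intro k
    exact (hK.measurable.comp (((φ k).measurable.comp measurable_fst).prodMk
      ((φ k).measurable.comp measurable_snd))).aestronglyMeasurable
  have hbd : ∀ k, ∀ z : (Fin n → ℝ) × (Fin n → ℝ), ‖K (φ k z.1) (φ k z.2)‖ ≤ C :=
    fun k z => hC (φ k z.1, φ k z.2) ⟨hφ k _, hφ k _⟩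
  have hprod : ∀ᵐ z ∂(μ.prod μ), z ∈ W ×ˢ W := by
    rw [hμ, Measure.prod_restrict]
    exact ae_restrict_mem (hWm.prod hWm)
  have hint : Integrable (fun z : (Fin n → ℝ) × (Fin n → ℝ) => K z.1 z.2) (μ.prod μ) :=
    Integrable.of_bound hK.measurable.aestronglyMeasurable C (hprod.mono fun z hz => hC z hz)
  have hlim := tendsto_integral_of_dominated_convergence (μ := μ.prod μ)
    (F := fun k (z : (Fin n → ℝ) × (Fin n → ℝ)) => K (φ k z.1) (φ k z.2))
    (f := fun z => K z.1 z.2) (fun _ => C) hmeas (integrable_const _)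
    (fun k => Filter.Eventually.of_forall (hbd k)) (by
      filter_upwards [hprod] with z hz
      have h1 := SimpleFunc.tendsto_approxOn (measurable_id (α := Fin n → ℝ)) h0 (x := z.1)
        (subset_closure hz.1)
      have h2 := SimpleFunc.tendsto_approxOn (measurable_id (α := Fin n → ℝ)) h0 (x := z.2)
        (subset_closure hz.2)
      exact (hK.tendsto z).comp (h1.prodMk_nhds h2))
  rw [integral_prod _ hint] at hlim
  refine ge_of_tendsto' hlim fun k => ?_
  rw [integral_prod _ (Integrable.of_bound (hmeas k) C (Filter.Eventually.of_forall (hbd k)))]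
  have e1 : ∀ x, ∫ y, K (φ k x) (φ k y) ∂μ =
      ∑ b ∈ (φ k).range, μ.real ((φ k) ⁻¹' {b}) * K (φ k x) b :=
    fun x => simple_integral μ (φ k) (fun b => K (φ k x) b)
  simp only [e1]
  rw [simple_integral μ (φ k) (fun a => ∑ b ∈ (φ k).range, μ.real ((φ k) ⁻¹' {b}) * K a b)]
  refine (hpos (φ k).range (fun a => μ.real ((φ k) ⁻¹' {a}))).trans_eq ?_
  refine Finset.sum_congr rfl fun a _ => ?_
  rw [Finset.mul_sum]
  refine Finset.sum_congr rfl fun b _ => ?_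
  ring

theorem int_sub3 {E : Type*} [MeasurableSpace E] {μ : Measure E} {a b c : E → ℝ}
    (ha : Integrable a μ) (hb : Integrable b μ) (hc : Integrable c μ) :
    ∫ x, (2 * a x - b x - c x) ∂μ = 2 * (∫ x, a x ∂μ) - (∫ x, b x ∂μ) - ∫ x, c x ∂μ := by
  rw [← integral_const_mul, ← integral_sub (ha.const_mul 2) hb, ← integral_sub _ hc]
  exact (ha.const_mul 2).sub hb

theorem double_bound {n : ℕ} {f : (Fin n → ℝ) → ℝ} (hc : Continuous f) (h0 : ∀ x, 0 ≤ f x)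
    (hf : IsPosDefR f) (W : Set (Fin n → ℝ)) (hW : IsCompact W) (hW0 : 0 ∈ W)
    (v : Fin n → ℝ) :
    ∫ x in W, ∫ y in W, f (y - x + v) ≤ 2 * ∫ x in W, ∫ y in W, f (y - x) := by
  have key := kernel_nonneg (fun x y => 2 * f (y - x) - f (y - x + v) - f (y - x - v))
    (by fun_prop) (by
      intro X w
      have := posdef_multi hf (X ×ˢ (Finset.univ : Finset Bool))
        (fun i => if i.2 then i.1 + v else i.1) (fun i => if i.2 then w i.1 else - w i.1)
      rw [Finset.sum_product] at this
      refine this.trans_eq ?_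
      rw [Finset.sum_comm (s := X) (t := X)]
      refine Finset.sum_congr rfl fun a _ => ?_
      simp only [Finset.sum_product, Fintype.univ_bool, Finset.mem_singleton, Bool.true_eq_false,
        not_false_eq_true, Finset.sum_insert, Finset.sum_singleton, if_true, Bool.false_eq_true,
        if_false]
      rw [← Finset.sum_add_distrib]
      refine Finset.sum_congr rfl fun b _ => ?_
      rw [show a + v - (b + v) = a - b by abel, show a + v - b = a - b + v by abel,
        show a - (b + v) = a - b - v by abel]
      ring) W hW hW0
  have hi : ∀ g : (Fin n → ℝ) → ℝ, Continuous g → ∀ x, IntegrableOn (fun y => g (y - x)) W :=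
    fun g hg x => (by fun_prop : Continuous fun y => g (y - x)).continuousOn.integrableOn_compact hW
  have hi2 : ∀ g : (Fin n → ℝ) → ℝ, Continuous g →
      IntegrableOn (fun x => ∫ y in W, g (y - x)) W := by
    intro g hg
    have : Continuous fun x => ∫ y in W, g (y - x) :=
      continuous_parametric_integral_of_continuous (f := fun x y => g (y - x))
        (by simp only [Function.uncurry_def]; fun_prop) hW
    exact this.continuousOn.integrableOn_compact hW
  have c1 : Continuous fun y => f (y + v) := by fun_prop
  have c2 : Continuous fun y => f (y - v) := by fun_prop
  have e : ∀ x, ∫ y in W, (2 * f (y - x) - f (y - x + v) - f (y - x - v)) =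
      2 * (∫ y in W, f (y - x)) - (∫ y in W, f (y - x + v)) - ∫ y in W, f (y - x - v) := by
    intro x
    exact int_sub3 (hi f hc x) (hi _ c1 x) (hi _ c2 x)
  simp only [e] at key
  rw [int_sub3 (hi2 f hc) (hi2 _ c1) (hi2 _ c2)] at key
  have : 0 ≤ ∫ x in W, ∫ y in W, f (y - x - v) :=
    integral_nonneg fun x => integral_nonneg fun y => h0 _
  linarith

theorem shift_int {n : ℕ} (f : (Fin n → ℝ) → ℝ) (W : Set (Fin n → ℝ)) (hW : MeasurableSet W)
    (u : Fin n → ℝ) : ∫ y in W, f (y - u) = ∫ z in (fun z => z + u) ⁻¹' W, f z := by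
  rw [← integral_indicator hW, ← integral_indicator ((measurable_add_const u) hW),
    ← integral_add_right_eq_self _ u]
  refine integral_congr_ae (Filter.Eventually.of_forall fun y => ?_)
  classical
  simp [Set.indicator_apply]

theorem ball_bound {n : ℕ} {f : (Fin n → ℝ) → ℝ} (hc : Continuous f) (h0 : ∀ x, 0 ≤ f x)
    (hf : IsPosDefR f) (U : Set (Fin n → ℝ)) (hU : IsCompact U) {r : ℝ} (hr : 0 < r)
    (hrU : Metric.closedBall 0 (2 * r) ⊆ U) (v : Fin n → ℝ) :
    (volume.real (Metric.closedBall (0 : Fin n → ℝ) (r / 2))) *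
      ∫ z in Metric.closedBall v (r / 2), f z ≤
      2 * (volume.real (Metric.closedBall (0 : Fin n → ℝ) r) * ∫ z in U, f z) := by
  set W := Metric.closedBall (0 : Fin n → ℝ) r with hWdef
  have hW : IsCompact W := isCompact_closedBall _ _
  have hmW := hW.measurableSet
  have hloc : ∀ S : Set (Fin n → ℝ), IsCompact S → IntegrableOn f S :=
    fun S hS => hc.continuousOn.integrableOn_compact hS
  have hpre : ∀ u : Fin n → ℝ, (fun z => z + u) ⁻¹' W = Metric.closedBall (-u) r := by
    intro u; ext z; simp [hWdef, dist_eq_norm]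
  have hdb := double_bound hc h0 hf W hW (by simp [hWdef, hr.le]) v
  have hcont : ∀ u, Continuous fun x => ∫ y in W, f (y - x + u) := fun u =>
    continuous_parametric_integral_of_continuous (f := fun x y => f (y - x + u))
        (by simp only [Function.uncurry_def]; fun_prop) hW
  have up : ∫ x in W, ∫ y in W, f (y - x) ≤ volume.real W * ∫ z in U, f z := by
    have : ∫ x in W, ∫ y in W, f (y - x) ≤ ∫ x in W, (∫ z in U, f z) := by
      have h1 := hcont 0
      simp only [add_zero] at h1
      refine setIntegral_mono_on (h1.continuousOn.integrableOn_compact hW)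
        (integrableOn_const hW.measure_lt_top.ne) hmW ?_
      intro x hx
      rw [shift_int f W hmW x, hpre]
      refine setIntegral_mono_set (hloc U hU) (Filter.Eventually.of_forall h0)
        (LE.le.eventuallyLE ?_)
      refine Set.Subset.trans ?_ hrU
      refine Metric.closedBall_subset_closedBall' ?_
      simp [hWdef] at hx
      simp; linarith
    refine this.trans_eq ?_
    rw [setIntegral_const, smul_eq_mul]
  have low : (volume.real (Metric.closedBall (0 : Fin n → ℝ) (r / 2))) *
      ∫ z in Metric.closedBall v (r / 2), f z ≤ ∫ x in W, ∫ y in W, f (y - x + v) := by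
    have hsub : Metric.closedBall (0 : Fin n → ℝ) (r / 2) ⊆ W :=
      Metric.closedBall_subset_closedBall (by linarith)
    calc _ = ∫ x in Metric.closedBall (0 : Fin n → ℝ) (r / 2),
          ∫ z in Metric.closedBall v (r / 2), f z := by rw [setIntegral_const, smul_eq_mul]
      _ ≤ ∫ x in Metric.closedBall (0 : Fin n → ℝ) (r / 2), ∫ y in W, f (y - x + v) := by
        refine setIntegral_mono_on (integrableOn_const (isCompact_closedBall _ _).measure_lt_top.ne)
          ((hcont v).continuousOn.integrableOn_compact (isCompact_closedBall _ _))
          measurableSet_closedBall ?_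
        intro x hx
        have : ∫ y in W, f (y - x + v) = ∫ y in W, f (y - (x - v)) := by
          simp only [sub_sub_eq_add_sub, sub_add_eq_add_sub]
        rw [this, shift_int f W hmW, hpre]
        refine setIntegral_mono_set (hloc _ (isCompact_closedBall _ _))
          (Filter.Eventually.of_forall h0) (LE.le.eventuallyLE ?_)
        refine Metric.closedBall_subset_closedBall' ?_
        simp at hx
        simp; linarith
      _ ≤ _ := setIntegral_mono_set ((hcont v).continuousOn.integrableOn_compact hW)
          (Filter.Eventually.of_forall fun x => integral_nonneg fun y => h0 _)
          (LE.le.eventuallyLE hsub)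
  linarith

theorem zero_mem_int {n : ℕ} {U : Set (Fin n → ℝ)} (hU : IsSymConvexBody U) : 0 ∈ interior U := by
  obtain ⟨h1, h2, ⟨x, hx⟩, h4⟩ := hU
  have hx' : -x ∈ interior U := by
    have := (Homeomorph.neg (Fin n → ℝ)).preimage_interior U
    have h5 : (Homeomorph.neg (Fin n → ℝ)) ⁻¹' U = U := by
      conv_rhs => rw [h4]
      rfl
    rw [h5] at this
    rw [← this] at hx
    exact hx
  have := h1.interior hx hx' (by norm_num : (0:ℝ) ≤ 1/2) (by norm_num : (0:ℝ) ≤ 1/2) (by norm_num)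
  simpa using this

theorem vol_pos {n : ℕ} {U : Set (Fin n → ℝ)} (hU : IsSymConvexBody U) :
    0 < (volume U).toReal :=
  ENNReal.toReal_pos (Measure.measure_pos_of_nonempty_interior _ hU.2.2.1).ne' hU.2.1.measure_lt_top.ne

theorem setIntegral_union_eq_aux {n : ℕ} (f : (Fin n → ℝ) → ℝ) (S T : Set (Fin n → ℝ))
    (hS : IntegrableOn f S) (hT : IntegrableOn f T) (hTm : MeasurableSet T) (h0 : ∀ x, 0 ≤ f x) :
    ∫ z in S ∪ T, f z ≤ (∫ z in S, f z) + ∫ z in T, f z := by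
  rw [← Set.sdiff_union_self, setIntegral_union Set.disjoint_sdiff_left hTm
    (hS.mono_set Set.sdiff_subset) hT]
  have := setIntegral_mono_set hS (Filter.Eventually.of_forall h0)
    (LE.le.eventuallyLE (Set.sdiff_subset (s := S) (t := T)))
  linarith

theorem ratio_bdd {n : ℕ} {U V : Set (Fin n → ℝ)} (hU : IsSymConvexBody U)
    (hV : IsSymConvexBody V) : BddAbove (ratioSet n U V) := by
  obtain ⟨ρ, hρ, hρU⟩ := Metric.nhds_basis_closedBall.mem_iff.1
    (mem_interior_iff_mem_nhds.1 (zero_mem_int hU))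
  set r := ρ / 2 with hr
  have hr0 : 0 < r := by positivity
  obtain ⟨t, ht⟩ := hV.2.1.elim_nhds_subcover (fun v => Metric.closedBall v (r / 2))
    (fun v _ => Metric.closedBall_mem_nhds _ (by positivity))
  set A := volume.real (Metric.closedBall (0 : Fin n → ℝ) (r / 2)) with hA
  set B := volume.real (Metric.closedBall (0 : Fin n → ℝ) r) with hB
  have hA0 : 0 < A := ENNReal.toReal_pos (Metric.measure_closedBall_pos _ _ (by positivity)).ne'
    (isCompact_closedBall _ _).measure_lt_top.ne
  refine ⟨(volume V).toReal⁻¹ * (t.card * (2 * B / A)) / (volume U).toReal⁻¹, ?_⟩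
  rintro c ⟨f, hc, h0, hf, -, hpos, rfl⟩
  have hb : ∀ v, ∫ z in Metric.closedBall v (r / 2), f z ≤ 2 * B / A * ∫ z in U, f z := by
    intro v
    have := ball_bound hc h0 hf U hU.2.1 hr0 (by rwa [hr, mul_div_cancel₀ _ two_ne_zero]) v
    rw [div_mul_eq_mul_div, le_div_iff₀ hA0]
    linarith
  have hloc : ∀ S : Set (Fin n → ℝ), IsCompact S → IntegrableOn f S :=
    fun S hS => hc.continuousOn.integrableOn_compact hS
  have hVb : ∫ z in V, f z ≤ t.card * (2 * B / A) * ∫ z in U, f z := by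
    have hun : ∀ t : Finset (Fin n → ℝ), ∫ z in ⋃ x ∈ t, Metric.closedBall x (r / 2), f z ≤
        ∑ x ∈ t, ∫ z in Metric.closedBall x (r / 2), f z := by
      classical
      intro t
      induction t using Finset.induction_on with
      | empty => simp
      | insert a s ha ih =>
        rw [Finset.sum_insert ha, Finset.set_biUnion_insert]
        have hS : IsCompact (⋃ x ∈ s, Metric.closedBall x (r / 2)) :=
          s.isCompact_biUnion fun x _ => isCompact_closedBall _ _
        have := hloc _ (isCompact_closedBall a (r/2))
        have h3 := setIntegral_union_eq_aux f (Metric.closedBall a (r/2)) _ this (hloc _ hS)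
          hS.measurableSet h0
        linarith
    have h1 : ∫ z in V, f z ≤ ∫ z in ⋃ x ∈ t, Metric.closedBall x (r / 2), f z :=
      setIntegral_mono_set (hloc _ (t.isCompact_biUnion fun x _ => isCompact_closedBall _ _))
          (Filter.Eventually.of_forall h0) (LE.le.eventuallyLE ht.2)
    refine (h1.trans (hun t)).trans ((Finset.sum_le_sum fun x _ => hb x).trans_eq ?_)
    rw [Finset.sum_const, nsmul_eq_mul]; ring
  have hu := vol_pos hU
  have hv := vol_pos hV
  rw [div_le_div_iff₀ (by positivity) (by positivity)]
  have : (volume V).toReal⁻¹ * (∫ z in V, f z) * (volume U).toReal⁻¹ ≤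
    (volume V).toReal⁻¹ * (t.card * (2 * B / A) * ∫ z in U, f z) * (volume U).toReal⁻¹ := by
    gcongr
  linarith
/-- autocorrelation of a function -/
def ac {n : ℕ} (H : (Fin n → ℝ) → ℝ) (x : Fin n → ℝ) : ℝ := ∫ y, H (x + y) * H y

theorem ac_cont {n : ℕ} {H : (Fin n → ℝ) → ℝ} (hc : Continuous H) (hs : HasCompactSupport H) :
    Continuous (ac H) := by
  have : ac H = fun x => ∫ y in tsupport H, H (x + y) * H y := by
    funext x
    refine (setIntegral_eq_integral_of_forall_compl_eq_zero fun y hy => ?_).symm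
    rw [image_eq_zero_of_notMem_tsupport hy, mul_zero]
  rw [this]
  exact continuous_parametric_integral_of_continuous (f := fun x y => H (x + y) * H y)
    (by simp only [Function.uncurry_def]; fun_prop) hs

theorem ac_posdef {n : ℕ} {H : (Fin n → ℝ) → ℝ} (hc : Continuous H) (hs : HasCompactSupport H) :
    IsPosDefR (ac H) := by
  intro X c
  have hint : ∀ a b, Integrable fun y => H (a + y) * H (b + y) := by
    intro a b
    refine Continuous.integrable_of_hasCompactSupport (by fun_prop) ?_
    exact HasCompactSupport.mul_left (hs.comp_homeomorph (Homeomorph.addLeft b))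
  have e : ∀ a b, ac H (a - b) = ∫ y, H (a + y) * H (b + y) := by
    intro a b
    unfold ac
    rw [← integral_add_right_eq_self _ b]
    refine integral_congr_ae (Filter.Eventually.of_forall fun y => ?_)
    simp only
    rw [show a - b + (y + b) = a + y by abel, add_comm y b]
  have key : (∑ a ∈ X, ∑ b ∈ X, c a * (starRingEnd ℂ) (c b) * (ac H (a - b) : ℂ)) =
      ((∫ y, Complex.normSq (∑ a ∈ X, c a * (H (a + y) : ℂ)) : ℝ) : ℂ) := by
    rw [← integral_complex_ofReal]
    have h1 : ∀ y, ((Complex.normSq (∑ a ∈ X, c a * (H (a + y) : ℂ)) : ℝ) : ℂ) =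
        ∑ a ∈ X, ∑ b ∈ X, c a * (starRingEnd ℂ) (c b) * ((H (a + y) * H (b + y) : ℝ) : ℂ) := by
      intro y
      rw [← Complex.mul_conj, map_sum, Finset.sum_mul_sum]
      refine Finset.sum_congr rfl fun a _ => Finset.sum_congr rfl fun b _ => ?_
      simp only [map_mul, Complex.conj_ofReal]
      push_cast
      ring
    simp only [h1]
    rw [integral_finsetSum]
    · refine Finset.sum_congr rfl fun a _ => ?_
      rw [integral_finsetSum]
      · refine Finset.sum_congr rfl fun b _ => ?_
        rw [integral_const_mul, integral_complex_ofReal, e]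
      · intro b _
        exact ((hint a b).ofReal).const_mul _
    · intro a _
      exact integrable_finsetSum _ fun b _ => ((hint a b).ofReal).const_mul _
  simp only
  rw [key]
  refine ⟨?_, by simp⟩
  rw [Complex.ofReal_re]
  exact integral_nonneg fun y => Complex.normSq_nonneg _

/-- tent function -/
def tent {n : ℕ} (ε : ℝ) (x : Fin n → ℝ) : ℝ := max 0 (ε / 2 - ‖x‖)

theorem tent_cont {n : ℕ} (ε : ℝ) : Continuous (tent (n := n) ε) := by
  unfold tent; fun_prop

theorem tent_supp {n : ℕ} (ε : ℝ) : HasCompactSupport (tent (n := n) ε) := by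
  refine HasCompactSupport.intro (isCompact_closedBall (0 : Fin n → ℝ) (ε / 2)) fun x hx => ?_
  simp at hx
  unfold tent
  exact max_eq_left (by linarith)

theorem tent_ac_zero {n : ℕ} (ε : ℝ) (x : Fin n → ℝ) (hx : ε ≤ ‖x‖) : ac (tent ε) x = 0 := by
  unfold ac
  rw [← integral_zero (Fin n → ℝ) ℝ]
  refine integral_congr_ae (Filter.Eventually.of_forall fun y => ?_)
  simp only [tent]
  rcases le_total (ε / 2) ‖y‖ with h | h
  · rw [max_eq_left (a := (0:ℝ)) (b := ε / 2 - ‖y‖) (by linarith), mul_zero]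
  · have : ‖x‖ ≤ ‖x + y‖ + ‖y‖ := by
      simpa using norm_sub_le (x + y) y
    rw [max_eq_left (a := (0:ℝ)) (b := ε / 2 - ‖x + y‖) (by linarith), zero_mul]

theorem tent_ac_nonneg {n : ℕ} (ε : ℝ) (x : Fin n → ℝ) : 0 ≤ ac (tent ε) x :=
  integral_nonneg fun y => mul_nonneg (le_max_left _ _) (le_max_left _ _)

theorem tent_ac_supp {n : ℕ} (ε : ℝ) : HasCompactSupport (ac (tent (n := n) ε)) := by
  refine HasCompactSupport.intro (isCompact_closedBall (0 : Fin n → ℝ) ε) fun x hx => ?_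
  simp at hx
  exact tent_ac_zero _ _ hx.le

theorem tent_ac_int_pos {n : ℕ} {ε : ℝ} (hε : 0 < ε) : 0 < ∫ x : Fin n → ℝ, ac (tent ε) x := by
  refine (ac_cont (tent_cont ε) (tent_supp ε)).integral_pos_of_hasCompactSupport_nonneg_nonzero
    (tent_ac_supp ε) (fun x => tent_ac_nonneg ε x) (x := 0) (ne_of_gt ?_)
  unfold ac
  refine Continuous.integral_pos_of_hasCompactSupport_nonneg_nonzero
    (by have := tent_cont (n := n) ε; fun_prop)
    (HasCompactSupport.mul_left (tent_supp ε))
    (fun x => mul_nonneg (le_max_left _ _) (le_max_left _ _)) (x := 0) ?_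
  have : 0 < tent (n := n) ε 0 := by simp [tent, hε]
  simp only [add_zero]
  positivity

theorem sum_ac {n : ℕ} {ι : Type*} (B : Finset ι) (g : ι → Fin n → ℝ) {h : (Fin n → ℝ) → ℝ}
    (hc : Continuous h) (hs : HasCompactSupport h) :
    (fun x => ∑ p ∈ B, ∑ q ∈ B, ac h (x - (g p - g q))) =
      ac (fun y => ∑ p ∈ B, h (y - g p)) := by
  funext x
  unfold ac
  have hsupp : ∀ u : Fin n → ℝ, HasCompactSupport fun y => h (y - u) := fun u => by
    simpa [sub_eq_add_neg] using! hs.comp_homeomorph (Homeomorph.addRight (-u))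
  have hint : ∀ p q, Integrable fun y => h (x + y - g p) * h (y - g q) := by
    intro p q
    exact Continuous.integrable_of_hasCompactSupport (by fun_prop)
      (HasCompactSupport.mul_left (hsupp (g q)))
  simp only [Finset.sum_mul_sum]
  rw [integral_finsetSum _ fun p _ => integrable_finsetSum _ fun q _ => hint p q]
  refine Finset.sum_congr rfl fun p _ => ?_
  rw [integral_finsetSum _ fun q _ => hint p q]
  refine Finset.sum_congr rfl fun q _ => ?_
  rw [← integral_sub_right_eq_self _ (g q)]
  refine integral_congr_ae (Filter.Eventually.of_forall fun y => ?_)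
  simp only
  rw [show x - (g p - g q) + (y - g q) = x + y - g p by abel]

theorem sum_supp {n : ℕ} {ι : Type*} (B : Finset ι) (g : ι → Fin n → ℝ) {h : (Fin n → ℝ) → ℝ}
    (hs : HasCompactSupport h) : HasCompactSupport fun y => ∑ p ∈ B, h (y - g p) := by
  classical
  have hsupp : ∀ u : Fin n → ℝ, HasCompactSupport fun y => h (y - u) := fun u => by
    simpa [sub_eq_add_neg] using! hs.comp_homeomorph (Homeomorph.addRight (-u))
  induction B using Finset.induction_on with
  | empty => simpa using! HasCompactSupport.zero
  | insert a s ha ih =>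
    simp only [Finset.sum_insert ha]
    exact (hsupp (g a)).add ih

/-- Main abstract step: translates `g p`, `p ∈ B`. -/
theorem lower_step {n : ℕ} {U V : Set (Fin n → ℝ)} (hU : IsSymConvexBody U)
    (hV : IsSymConvexBody V) {ι : Type*} [AddCommGroup ι] (g : ι →+ (Fin n → ℝ))
    {ε : ℝ} (hε : 0 < ε) (hεU : ∀ x, ‖x‖ < ε → x ∈ U)
    (hsep : ∀ k, k ≠ 0 → ∀ x ∈ U, ε ≤ ‖x - g k‖)
    (T : Finset ι) (hT : ∀ k ∈ T, ∀ x, ‖x - g k‖ < ε → x ∈ V)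
    (B B' : Finset ι) (hB : B.Nonempty) (hB' : B' ⊆ B) (hBT : ∀ k ∈ T, ∀ q ∈ B', q + k ∈ B) :
    ((T.card : ℝ) * B'.card / B.card) * ((volume U).toReal / (volume V).toReal) ≤
      doublingConst n U V := by
  classical
  set φ := ac (tent (n := n) ε) with hφ
  have φc : Continuous φ := ac_cont (tent_cont ε) (tent_supp ε)
  have φ0 : ∀ x, 0 ≤ φ x := tent_ac_nonneg ε
  set I := ∫ x, φ x with hI
  have hIpos : 0 < I := tent_ac_int_pos hε
  let f : (Fin n → ℝ) → ℝ := fun x => ∑ p ∈ B, ∑ q ∈ B, φ (x - (g p - g q))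
  have hfac : f = ac (fun y => ∑ p ∈ B, tent ε (y - g p)) := sum_ac B g (tent_cont ε) (tent_supp ε)
  have hHc : Continuous fun y => ∑ p ∈ B, tent ε (y - g p) := by
    have := tent_cont (n := n) ε
    fun_prop
  have hHs : HasCompactSupport fun y => ∑ p ∈ B, tent ε (y - g p) := by
    exact sum_supp B g (tent_supp ε)
  have hfpd : IsPosDefR f := by rw [hfac]; exact ac_posdef hHc hHs
  have hfc : Continuous f := by rw [hfac]; exact ac_cont hHc hHs
  have hf0 : ∀ x, 0 ≤ f x := fun x => Finset.sum_nonneg fun p _ => Finset.sum_nonneg fun q _ => φ0 _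
  have hloc : ∀ (S : Set (Fin n → ℝ)) (u), IsCompact S → IntegrableOn (fun x => φ (x - u)) S :=
    fun S u hS => (by fun_prop : Continuous fun x => φ (x - u)).continuousOn.integrableOn_compact hS
  have hsum : ∀ S : Set (Fin n → ℝ), IsCompact S →
      ∫ x in S, f x = ∑ q ∈ B, ∑ p ∈ B, ∫ x in S, φ (x - (g p - g q)) := by
    intro S hS
    rw [Finset.sum_comm]
    simp only [f]
    rw [integral_finsetSum _ fun p _ => integrable_finsetSum _ fun q _ => hloc S _ hS]
    refine Finset.sum_congr rfl fun p _ => ?_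
    rw [integral_finsetSum _ fun q _ => hloc S _ hS]
  have hUint : ∫ x in U, f x = B.card * I := by
    rw [hsum U hU.2.1]
    have : ∀ q ∈ B, ∑ p ∈ B, ∫ x in U, φ (x - (g p - g q)) = I := by
      intro q hq
      rw [Finset.sum_eq_single q]
      · simp only [sub_self, sub_zero]
        refine setIntegral_eq_integral_of_forall_compl_eq_zero fun x hx => ?_
        exact tent_ac_zero _ _ (not_lt.1 fun h => hx (hεU x h))
      · intro p _ hpq
        refine setIntegral_eq_zero_of_forall_eq_zero fun x hx => ?_
        rw [← map_sub]
        exact tent_ac_zero _ _ (hsep _ (sub_ne_zero.2 hpq) x hx)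
      · exact fun h => absurd hq h
    rw [Finset.sum_congr rfl this]; simp
  have hVint : T.card * B'.card * I ≤ ∫ x in V, f x := by
    rw [hsum V hV.2.1]
    have nn : ∀ u, 0 ≤ ∫ x in V, φ (x - u) := fun u => integral_nonneg fun x => φ0 _
    calc (T.card * B'.card * I : ℝ) = ∑ q ∈ B', ∑ k ∈ T, I := by simp; ring
      _ ≤ ∑ q ∈ B', ∑ p ∈ B, ∫ x in V, φ (x - (g p - g q)) := by
        refine Finset.sum_le_sum fun q hq => ?_
        have hi : ∑ k ∈ T, I = ∑ p ∈ T.image (fun k => q + k), ∫ x in V, φ (x - (g p - g q)) := by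
          rw [Finset.sum_image (fun a _ b _ h => add_left_cancel h)]
          refine Finset.sum_congr rfl fun k hk => ?_
          rw [map_add, add_sub_cancel_left, hI, ← integral_sub_right_eq_self φ (g k)]
          refine (setIntegral_eq_integral_of_forall_compl_eq_zero fun x hx => ?_).symm
          exact tent_ac_zero _ _ (not_lt.1 fun h => hx (hT k hk x h))
        rw [hi]
        refine Finset.sum_le_sum_of_subset_of_nonneg ?_ fun p _ _ => nn _
        intro p hp
        obtain ⟨k, hk, rfl⟩ := Finset.mem_image.1 hp
        exact hBT k hk q hq
      _ ≤ _ := Finset.sum_le_sum_of_subset_of_nonneg hB' fun q _ _ =>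
          Finset.sum_nonneg fun p _ => nn _
  have hu := vol_pos hU
  have hv := vol_pos hV
  have hBc : (0:ℝ) < B.card := by exact_mod_cast hB.card_pos
  have hUpos : 0 < ∫ x in U, f x := by rw [hUint]; positivity
  have hmem : ((volume V).toReal⁻¹ * ∫ x in V, f x) / ((volume U).toReal⁻¹ * ∫ x in U, f x) ∈
      ratioSet n U V := by
    refine ⟨f, hfc, hf0, hfpd, ?_, hUpos, rfl⟩
    intro h
    rw [h] at hUpos
    simp at hUpos
  refine le_trans ?_ (le_csSup (ratio_bdd hU hV) hmem)
  rw [hUint]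
  calc _ = ((volume V).toReal⁻¹ * (T.card * B'.card * I)) /
        ((volume U).toReal⁻¹ * (B.card * I)) := by field_simp
    _ ≤ _ := by gcongr

theorem doubling_nonneg {n : ℕ} (U V : Set (Fin n → ℝ)) : 0 ≤ doublingConst n U V := by
  refine Real.sSup_nonneg ?_
  rintro c ⟨f, hc, h0, hf, -, hpos, rfl⟩
  have : 0 ≤ ∫ x in V, f x := integral_nonneg h0
  positivity

/-- The scaled lattice map. -/
def latMap {n : ℕ} (M : Matrix (Fin n) (Fin n) ℝ) (t : ℝ) : (Fin n → ℤ) →+ (Fin n → ℝ) where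
  toFun m := t • M.mulVec (fun i => (m i : ℝ))
  map_zero' := by
    have : (fun i : Fin n => (((0 : Fin n → ℤ) i : ℤ) : ℝ)) = 0 := by ext; simp
    rw [this]; simp
  map_add' a b := by
    have : (fun i : Fin n => (((a + b) i : ℤ) : ℝ)) = (fun i => (a i : ℝ)) + fun i => (b i : ℝ) := by
      ext; simp
    rw [this, Matrix.mulVec_add, smul_add]

theorem exists_scale {n : ℕ} {U V : Set (Fin n → ℝ)} (hU : IsSymConvexBody U)
    (M : Matrix (Fin n) (Fin n) ℝ)
    (hp : ∀ k : Fin n → ℤ, k ≠ 0 → latMap M 1 k ∉ interior U) (T : Finset (Fin n → ℤ))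
    (hT : ∀ k ∈ T, latMap M 1 k ∈ interior V) :
    ∃ t ε : ℝ, 0 < ε ∧ (∀ x, ‖x‖ < ε → x ∈ U) ∧
      (∀ k, k ≠ 0 → ∀ x ∈ U, ε ≤ ‖x - latMap M t k‖) ∧
      (∀ k ∈ T, ∀ x, ‖x - latMap M t k‖ < ε → x ∈ V) := by
  have hlat : ∀ t k, latMap M t k = t • latMap M 1 k := by
    intro t k; simp [latMap]
  have h0 := zero_mem_int hU
  -- choose t
  have ev : ∀ᶠ t in nhdsWithin (1:ℝ) (Set.Ioi 1), ∀ k ∈ T, latMap M t k ∈ interior V := by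
    rw [Filter.eventually_all_finset]
    intro k hk
    have hc : Continuous fun t : ℝ => latMap M t k := by
      simp only [latMap, AddMonoidHom.coe_mk, ZeroHom.coe_mk]; fun_prop
    exact (hc.continuousAt.eventually (isOpen_interior.mem_nhds (hT k hk))).filter_mono
      nhdsWithin_le_nhds
  obtain ⟨t, htT, ht1⟩ := (ev.and self_mem_nhdsWithin).exists
  have ht1 : (1:ℝ) < t := ht1
  have ht0 : t ≠ 0 := by positivity
  have hsub : U ⊆ t • interior U := by
    have := subset_closure.trans
      (hU.1.closure_subset_image_homothety_interior_of_one_lt h0 t ht1)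
    rintro x hx
    obtain ⟨y, hy, rfl⟩ := this hx
    exact ⟨y, hy, by simp [AffineMap.homothety_apply]⟩
  obtain ⟨ε1, hε1, h1⟩ := hU.2.1.exists_thickening_subset_open
    (isOpen_interior.smul₀ ht0) hsub
  obtain ⟨ε2, hε2, h2⟩ := Metric.isOpen_iff.1 isOpen_interior 0 h0
  have hTc : IsCompact ((fun k => latMap M t k) '' (T : Set (Fin n → ℤ))) :=
    (T.finite_toSet.image _).isCompact
  obtain ⟨ε3, hε3, h3⟩ := hTc.exists_thickening_subset_open (isOpen_interior (s := V)) (by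
    rintro _ ⟨k, hk, rfl⟩; exact htT k hk)
  refine ⟨t, min ε1 (min ε2 ε3), by positivity, ?_, ?_, ?_⟩
  · intro x hx
    refine interior_subset (h2 ?_)
    simp only [Metric.mem_ball, dist_zero_right]
    exact hx.trans_le ((min_le_right _ _).trans (min_le_left _ _))
  · intro k hk x hx
    by_contra! hlt
    have : latMap M t k ∈ Metric.thickening ε1 U := by
      rw [Metric.mem_thickening_iff]
      refine ⟨x, hx, ?_⟩
      rw [dist_comm, dist_eq_norm]
      exact hlt.trans_le (min_le_left _ _)
    obtain ⟨y, hy, he⟩ := h1 this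
    rw [hlat] at he
    have : y = latMap M 1 k := smul_right_injective _ ht0 he
    exact hp k hk (this ▸ hy)
  · intro k hk x hx
    refine interior_subset (h3 ?_)
    rw [Metric.mem_thickening_iff]
    refine ⟨_, ⟨k, hk, rfl⟩, ?_⟩
    rw [dist_eq_norm]
    exact hx.trans_le ((min_le_right _ _).trans (min_le_right _ _))

theorem core {n : ℕ} {U V : Set (Fin n → ℝ)} (hU : IsSymConvexBody U)
    (hV : IsSymConvexBody V) (M : Matrix (Fin n) (Fin n) ℝ)
    (hp : ∀ k : Fin n → ℤ, k ≠ 0 → latMap M 1 k ∉ interior U) (T : Finset (Fin n → ℤ))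
    (hT : ∀ k ∈ T, latMap M 1 k ∈ interior V) :
    (T.card : ℝ) * ((volume U).toReal / (volume V).toReal) ≤ doublingConst n U V := by
  obtain ⟨t, ε, hε, h1, h2, h3⟩ := exists_scale hU M hp T hT
  -- bound on coordinates
  obtain ⟨K, hK⟩ : ∃ K : ℕ, ∀ k ∈ T, ∀ i, |k i| ≤ K := by
    refine ⟨∑ k ∈ T, ∑ i, (k i).natAbs, fun k hk i => ?_⟩
    have a1 : (k i).natAbs ≤ ∑ i, (k i).natAbs :=
      Finset.single_le_sum (f := fun i => (k i).natAbs) (fun _ _ => Nat.zero_le _)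
        (Finset.mem_univ i)
    have a2 : ∑ i, (k i).natAbs ≤ ∑ k ∈ T, ∑ i, (k i).natAbs :=
      Finset.single_le_sum (f := fun k : Fin n → ℤ => ∑ i, (k i).natAbs)
        (fun _ _ => Nat.zero_le _) hk
    rw [Int.abs_eq_natAbs]
    exact_mod_cast a1.trans a2
  have step : ∀ R : ℕ, 0 < R → ((T.card : ℝ) * ((R : ℝ) ^ n / ((R : ℝ) + 2 * K) ^ n)) *
      ((volume U).toReal / (volume V).toReal) ≤ doublingConst n U V := by
    intro R hR
    let B : Finset (Fin n → ℤ) := Fintype.piFinset fun _ => Finset.Ico (-K : ℤ) (R + K)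
    let B' : Finset (Fin n → ℤ) := Fintype.piFinset fun _ => Finset.Ico (0 : ℤ) R
    have hsub : B' ⊆ B := by
      intro q hq
      simp only [B, B', Fintype.mem_piFinset, Finset.mem_Ico] at hq ⊢
      intro i; have := hq i; omega
    have hB'c : B'.card = R ^ n := by simp [B']
    have hBc : B.card = (R + 2 * K) ^ n := by
      simp only [B, Fintype.card_piFinset, Int.card_Ico, Finset.prod_const, Finset.card_univ,
        Fintype.card_fin]
      congr 1; omega
    have hBne : B.Nonempty := by
      rw [← Finset.card_pos, hBc]; positivity
    have := lower_step hU hV (latMap M t) hε h1 h2 T h3 B B' hBne hsub (by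
      intro k hk q hq
      simp only [B, B', Fintype.mem_piFinset, Finset.mem_Ico] at hq ⊢
      intro i
      have a1 := hq i
      have a2 := abs_le.1 (hK k hk i)
      simp only [Pi.add_apply]
      omega)
    rw [hB'c, hBc] at this
    push_cast at this
    rwa [mul_div_assoc] at this
  have hlim : Filter.Tendsto (fun R : ℕ => ((T.card : ℝ) * ((R : ℝ) ^ n / ((R : ℝ) + 2 * K) ^ n)) *
      ((volume U).toReal / (volume V).toReal)) Filter.atTop
      (nhds (((T.card : ℝ) * (1 ^ n)) * ((volume U).toReal / (volume V).toReal))) := by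
    refine Filter.Tendsto.mul_const _ (Filter.Tendsto.const_mul _ ?_)
    simp only [← div_pow]
    refine Filter.Tendsto.pow ?_ n
    exact tendsto_natCast_div_add_atTop (2 * K : ℝ)
  rw [one_pow, mul_one] at hlim
  exact le_of_tendsto hlim ((Filter.eventually_gt_atTop 0).mono step)

/-- Lattice packing lower bound: if `Λ = Mℤⁿ` is a full-rank lattice with
`a - b ∉ int U` for distinct `a, b ∈ Λ`, then
`C_n(U,V) ≥ |Λ ∩ int V| |U| / |V|`. -/
theorem doublingConst_lattice_lower_bound {n : ℕ} (U V : Set (Fin n → ℝ))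
    (hU : IsSymConvexBody U) (hV : IsSymConvexBody V)
    (M : Matrix (Fin n) (Fin n) ℝ) (hM : M.det ≠ 0)
    (Λ : Set (Fin n → ℝ))
    (hΛ : Λ = Set.range (fun m : Fin n → ℤ => M.mulVec (fun i => (m i : ℝ))))
    (hpack : ∀ a ∈ Λ, ∀ b ∈ Λ, a ≠ b → a - b ∉ interior U) :
    ((Λ ∩ interior V).ncard : ℝ) * (volume U).toReal / (volume V).toReal ≤
      doublingConst n U V := by
  have hl : ∀ m : Fin n → ℤ, latMap M 1 m = M.mulVec (fun i => (m i : ℝ)) := by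
    intro m; simp [latMap]
  have hΛ' : Λ = Set.range (latMap M 1) := by
    rw [hΛ]; congr 1; funext m; exact (hl m).symm
  have hker : ∀ k, latMap M 1 k = 0 → k = 0 := by
    intro k hk
    rw [hl] at hk
    have := Matrix.eq_zero_of_mulVec_eq_zero hM hk
    funext i
    have h2 : (k i : ℝ) = 0 := congrFun this i
    exact_mod_cast h2
  have hinj : Function.Injective (latMap M 1) := (injective_iff_map_eq_zero _).2 hker
  have hp : ∀ k : Fin n → ℤ, k ≠ 0 → latMap M 1 k ∉ interior U := by
    intro k hk
    have := hpack (latMap M 1 k) (hΛ' ▸ ⟨k, rfl⟩) 0 (hΛ' ▸ ⟨0, map_zero _⟩) (fun h => hk (hker k h))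
    simpa using this
  have himg : Λ ∩ interior V = latMap M 1 '' {k | latMap M 1 k ∈ interior V} := by
    rw [hΛ']; ext x; constructor
    · rintro ⟨⟨k, rfl⟩, hx⟩; exact ⟨k, hx, rfl⟩
    · rintro ⟨k, hk, rfl⟩; exact ⟨⟨k, rfl⟩, hk⟩
  rw [himg, Set.ncard_image_of_injective _ hinj]
  by_cases hfin : {k | latMap M 1 k ∈ interior V}.Finite
  · rw [Set.ncard_eq_toFinset_card _ hfin, mul_div_assoc]
    exact core hU hV M hp _ fun k hk => by simpa using hk
  · rw [Set.Infinite.ncard hfin]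
    simpa using doubling_nonneg U V
end
end
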